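/- Let χ : ℝ → ℝ be antitone and satisfy χ(2t) ≤ M·χ(t) for all t ≤ 0 with M ≥ 1, let ρ : ℝ → ℝ be nonnegative with support contained in (0,1) and ∫_ℝ ρ(s) ds = 1, and for an integer j ≥ 1 define χ_j(t) = ∫₀¹ χ(t − s/j)·ρ(s) ds. Then χ_j(2t) ≤ M·χ_j(t) for every t ≤ 0. -/

import Mathlib

open MeasureTheory in
theorem IntervalIntegrable.monotone_mul {f g : ℝ → ℝ} {a b : ℝ} (hf : Monotone f)
    (hg : IntervalIntegrable g volume a b) :
    IntervalIntegrable (fun s => f s * g s) volume a b := by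
  rw [intervalIntegrable_iff] at hg ⊢
  refine hg.bdd_mul (c := max |f (min a b)| |f (max a b)|)
    hf.measurable.aestronglyMeasurable ?_
  filter_upwards [ae_restrict_mem measurableSet_uIoc] with s hs
  rw [Real.norm_eq_abs]
  exact abs_le_max_abs_abs (hf hs.1.le) (hf hs.2)

/-- The mollified regularization `χ_j(t) = ∫₀¹ χ(t − s/j)·ρ(s) ds` of an antitone weight
`χ ∈ 𝒜_M` satisfies the same doubling condition `χ_j(2t) ≤ M·χ_j(t)` for `t ≤ 0`. -/
theorem mollification_doubling (χ : ℝ → ℝ) (hχa : Antitone χ)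
    (M : ℝ) (hM : 1 ≤ M) (hdouble : ∀ t ≤ (0 : ℝ), χ (2 * t) ≤ M * χ t)
    (ρ : ℝ → ℝ) (hρ0 : ∀ s, 0 ≤ ρ s) (hρsupp : Function.support ρ ⊆ Set.Ioo 0 1)
    (hρint : ∫ s, ρ s = 1)
    (j : ℕ) (hj : 1 ≤ j) (t : ℝ) (ht : t ≤ 0) :
    (∫ s in (0:ℝ)..1, χ (2 * t - s / (j : ℝ)) * ρ s)
      ≤ M * ∫ s in (0:ℝ)..1, χ (t - s / (j : ℝ)) * ρ s := by
  have hρi : MeasureTheory.Integrable ρ := by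
    by_contra h
    simp [MeasureTheory.integral_undef h] at hρint
  have hint (a : ℝ) : IntervalIntegrable (fun s => χ (a - s / (j : ℝ)) * ρ s)
      MeasureTheory.volume 0 1 := by
    refine IntervalIntegrable.monotone_mul (fun x y hxy => hχa ?_) hρi.intervalIntegrable
    gcongr
  rw [← intervalIntegral.integral_const_mul]
  refine intervalIntegral.integral_mono_on zero_le_one (hint _) ((hint t).const_mul M) ?_
  intro s hs
  have hsj : 0 ≤ s / (j : ℝ) := div_nonneg hs.1 j.cast_nonneg
  rw [← mul_assoc]
  refine mul_le_mul_of_nonneg_right ?_ (hρ0 s)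
  calc χ (2 * t - s / j) ≤ χ (2 * (t - s / j)) := hχa (by linarith)
    _ ≤ M * χ (t - s / j) := hdouble _ (by linarith)
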